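/- Suppose 1/δ < γ* < +∞ and ζ(c) < γ* for every c ∈ (0,1). Then no feasible quantile function attains the supremum of the objective value over feasible quantile functions; i.e., every feasible quantile function has objective value strictly less than γ*·x, which is the supremum. -/

import Mathlib

open MeasureTheory Set Filter Topology ENNReal

noncomputable section

/-- The CDF of a random variable `ρ` under the measure `μ`. -/
def cdfFun {Ω : Type*} [MeasurableSpace Ω] (μ : Measure Ω) (ρ : Ω → ℝ) : ℝ → ℝ :=
  fun t => (μ {ω | ρ ω ≤ t}).toReal

/-- The right-continuous quantile function of `ρ`:
`F_ρ⁻¹(z) = inf {t : F_ρ(t) > z}`. -/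
def rcInv {Ω : Type*} [MeasurableSpace Ω] (μ : Measure Ω) (ρ : Ω → ℝ) : ℝ → ℝ :=
  fun z => sInf {t : ℝ | z < cdfFun μ ρ t}

/-- A feasible quantile function for pricing-density `F = F_ρ⁻¹` and initial wealth `x`:
nondecreasing and right-continuous on `(0,1)`, with `lim_{z↓0} G(z) ≥ 0`, satisfying the
budget constraint `∫_0^1 F(1-z) G(z) dz ≤ x`. -/
def Feasible (F : ℝ → ℝ) (x : ℝ) (G : ℝ → ℝ) : Prop :=
  MonotoneOn G (Set.Ioo 0 1)
  ∧ (∀ z ∈ Set.Ioo (0:ℝ) 1, Filter.Tendsto G (nhdsWithin z (Set.Ioi z)) (nhds (G z)))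
  ∧ (∃ L, 0 ≤ L ∧ Filter.Tendsto G (nhdsWithin 0 (Set.Ioi 0)) (nhds L))
  ∧ ∫⁻ z in Set.Ioo (0:ℝ) 1, ENNReal.ofReal (F (1 - z) * G z) ≤ ENNReal.ofReal x

/-- The extension `Ḡ` of a (nonnegative) quantile function `G` from `(0,1)` to `[0,1]`,
valued in `[0,∞]`, with `Ḡ(0) = lim_{z↓0} G(z)` and `Ḡ(1) = lim_{z↑1} G(z)`
(these limits are the inf/sup over `(0,1)` since `G` is nondecreasing). -/
def Gbar (G : ℝ → ℝ) : ℝ → ℝ≥0∞ := fun z =>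
  if z = 0 then ⨅ y ∈ Set.Ioo (0:ℝ) 1, ENNReal.ofReal (G y)
  else if z = 1 then ⨆ y ∈ Set.Ioo (0:ℝ) 1, ENNReal.ofReal (G y)
  else ENNReal.ofReal (G z)

/-- The objective value `∫_{[0,1]} Ḡ(z) m(dz)` of a quantile function `G`
(for `m` a Borel probability measure carried by `[0,1]`). -/
def objVal (m : Measure ℝ) (G : ℝ → ℝ) : ℝ≥0∞ := ∫⁻ z, Gbar G z ∂m

/-- `ζ(c) = m([c,1]) / ∫_c^1 F(1-z) dz`. -/
def zeta (F : ℝ → ℝ) (m : Measure ℝ) (c : ℝ) : ℝ :=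
  (m (Set.Icc c 1)).toReal / ∫ z in c..1, F (1 - z)

lemma rcInv_pos {Ω : Type*} [MeasurableSpace Ω] (μ : Measure Ω) [IsProbabilityMeasure μ]
    {ρ : Ω → ℝ} (hρmeas : Measurable ρ) (hρpos : ∀ ω, 0 < ρ ω)
    (hcdf : Continuous (cdfFun μ ρ)) {z : ℝ} (hz : z ∈ Ioo (0 : ℝ) 1) : 0 < rcInv μ ρ z := by
  have hzero : ∀ t ≤ 0, cdfFun μ ρ t = 0 := by
    intro t ht
    have : {ω | ρ ω ≤ t} = ∅ := by
      ext ω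
      simpa using lt_of_le_of_lt ht (hρpos ω)
    simp [cdfFun, this]
  have htop : Tendsto (cdfFun μ ρ) atTop (𝓝 1) := by
    have := Measure.isProbabilityMeasure_map (μ := μ) hρmeas.aemeasurable
    have h := ProbabilityTheory.tendsto_cdf_atTop (μ.map ρ)
    refine h.congr fun t => ?_
    rw [ProbabilityTheory.cdf_eq_real, measureReal_def, Measure.map_apply hρmeas measurableSet_Iic]
    rfl
  have hne : {t : ℝ | z < cdfFun μ ρ t}.Nonempty := (htop.eventually_const_lt hz.2).exists
  obtain ⟨ε, hε, hball⟩ := Metric.eventually_nhds_iff.1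
    ((hcdf.tendsto 0).eventually_lt_const (by rw [hzero 0 le_rfl]; exact hz.1))
  refine hε.trans_le (le_csInf hne fun t ht => ?_)
  by_contra! hlt
  rcases le_or_gt t 0 with h0 | h0
  · have : z < cdfFun μ ρ t := ht
    rw [hzero t h0] at this
    exact this.not_gt hz.1
  · have := hball (y := t) (by simpa [abs_of_pos h0] using hlt)
    exact lt_asymm this ht

/-- If `ν` strictly dominates `m` on the upper tails, it strictly dominates it on nonzero
nonnegative nondecreasing functions of finite `m`-integral. -/
lemma lintegral_lt_of_tail_lt {m ν : Measure ℝ} (hm : m (Ico (0 : ℝ) 1)ᶜ = 0)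
    (h0 : m (Ico 0 1) < ν (Ioo 0 1)) (hc : ∀ c ∈ Ioo (0 : ℝ) 1, m (Icc c 1) < ν (Ioo c 1))
    {g : ℝ → ℝ} (hg : MonotoneOn g (Ico 0 1)) (hg0 : ∀ z, 0 ≤ g z)
    (hgm : AEMeasurable g m) (hgν : AEMeasurable g ν)
    (hfin : ∫⁻ z, ENNReal.ofReal (g z) ∂ν ≠ ∞) (hpos : ∃ z ∈ Ioo (0 : ℝ) 1, 0 < g z) :
    ∫⁻ z, ENNReal.ofReal (g z) ∂m < ∫⁻ z, ENNReal.ofReal (g z) ∂ν := by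
  have key : ∀ t : ℝ, (∃ z ∈ Ico (0 : ℝ) 1, t < g z) →
      m {a | t < g a} < ν {a | t < g a} := by
    rintro t ⟨z, hz, htz⟩
    rw [← measure_inter_conull hm]
    set A : Set ℝ := {a | t < g a} ∩ Ico 0 1 with hA
    have hAne : A.Nonempty := ⟨z, htz, hz⟩
    have hbdd : BddBelow A := ⟨0, fun a ha => ha.2.1⟩
    have hsub : Ioo (sInf A) 1 ⊆ {a | t < g a} := by
      intro b hb
      obtain ⟨a, ha, hab⟩ := exists_lt_of_csInf_lt hAne hb.1
      exact lt_of_lt_of_le ha.1 (hg ha.2 ⟨ha.2.1.trans hab.le, hb.2⟩ hab.le)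
    have hlow : 0 ≤ sInf A := le_csInf hAne fun a ha => ha.2.1
    have hupp : sInf A < 1 := (csInf_le hbdd ⟨htz, hz⟩).trans_lt hz.2
    refine lt_of_lt_of_le ?_ (measure_mono hsub)
    rcases hlow.eq_or_lt with h | h
    · rw [← h]
      exact (measure_mono inter_subset_right).trans_lt h0
    · exact (measure_mono (t := Icc (sInf A) 1)
        fun a ha => ⟨csInf_le hbdd ha, ha.2.2.le⟩).trans_lt (hc _ ⟨h, hupp⟩)
  have hle : ∀ t : ℝ, m {a | t < g a} ≤ ν {a | t < g a} := by
    intro t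
    by_cases h : ∃ z ∈ Ico (0 : ℝ) 1, t < g z
    · exact (key t h).le
    · have : {a | t < g a} ∩ Ico 0 1 = ∅ := by
        ext a
        simp only [mem_inter_iff, mem_ofPred_eq, mem_empty_iff_false, iff_false]
        exact fun ha => h ⟨a, ha.2, ha.1⟩
      rw [← measure_inter_conull hm, this, measure_empty]
      exact zero_le
  rw [lintegral_eq_lintegral_meas_lt ν (ae_of_all _ hg0) hgν] at hfin ⊢
  rw [lintegral_eq_lintegral_meas_lt m (ae_of_all _ hg0) hgm]
  obtain ⟨z, hz, hgz⟩ := hpos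
  refine lintegral_strict_mono_of_ae_le_of_ae_lt_on (s := Ioo 0 (g z)) ?_
    (ne_top_of_le_ne_top hfin (lintegral_mono hle)) (ae_of_all _ hle) ?_
    (ae_of_all _ fun t ht => key t ⟨z, Ioo_subset_Ico_self hz, ht.2⟩)
  · refine Antitone.measurable (fun s t hst => ?_) |>.aemeasurable
    exact measure_mono fun a ha => lt_of_le_of_lt hst ha
  · rw [Measure.restrict_apply measurableSet_Ioo, inter_eq_left.2 Ioo_subset_Ioi_self]
    simpa using hgz

section Pricing

variable {F : ℝ → ℝ} {m : Measure ℝ} {γ x : ℝ}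

lemma intervalIntegral_comp_one_sub_pos (hF : ∀ z ∈ Ioo (0 : ℝ) 1, 0 < F z)
    (hint : IntervalIntegrable (fun z => F (1 - z)) volume 0 1) {c : ℝ} (hc : c ∈ Ico (0 : ℝ) 1) :
    0 < ∫ z in c..1, F (1 - z) := by
  refine intervalIntegral.intervalIntegral_pos_of_pos_on
    (hint.mono_set ?_) (fun z hz => hF _ ⟨by linarith [hz.2], by linarith [hz.1, hc.1]⟩) hc.2
  rw [uIcc_of_le hc.2.le, uIcc_of_le zero_le_one]
  exact Icc_subset_Icc_left hc.1

lemma setLIntegral_comp_one_sub (hF : ∀ z ∈ Ioo (0 : ℝ) 1, 0 < F z)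
    (hint : IntervalIntegrable (fun z => F (1 - z)) volume 0 1) {c a : ℝ} (ha : 0 ≤ a)
    (hc : c ∈ Ico (0 : ℝ) 1) :
    ∫⁻ z in Ioo c 1, ENNReal.ofReal (a * F (1 - z))
      = ENNReal.ofReal (a * ∫ z in c..1, F (1 - z)) := by
  rw [intervalIntegral.integral_of_le hc.2.le, integral_Ioc_eq_integral_Ioo,
    ← integral_const_mul, ofReal_integral_eq_lintegral_ofReal]
  · refine Integrable.const_mul ?_ a
    refine (hint.1.mono_set ?_)
    exact fun z hz => ⟨hc.1.trans_lt hz.1, hz.2.le⟩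
  · refine (ae_restrict_iff' measurableSet_Ioo).2 (ae_of_all _ fun z hz => ?_)
    exact mul_nonneg ha (hF _ ⟨by linarith [hz.2], by linarith [hz.1, hc.1]⟩).le

lemma measure_Icc_lt_of_zeta_lt [IsFiniteMeasure m] (hF : ∀ z ∈ Ioo (0 : ℝ) 1, 0 < F z)
    (hint : IntervalIntegrable (fun z => F (1 - z)) volume 0 1) {c : ℝ} (hc : c ∈ Ioo (0 : ℝ) 1)
    (h : zeta F m c < γ) :
    m (Icc c 1) < ENNReal.ofReal (γ * ∫ z in c..1, F (1 - z)) := by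
  rw [zeta, div_lt_iff₀
    (intervalIntegral_comp_one_sub_pos hF hint (Ioo_subset_Ico_self hc))] at h
  exact (ENNReal.lt_ofReal_iff_toReal_lt (measure_ne_top _ _)).2 h

lemma measure_singleton_one_eq_zero [IsFiniteMeasure m] (hF : ∀ z ∈ Ioo (0 : ℝ) 1, 0 < F z)
    (hint : IntervalIntegrable (fun z => F (1 - z)) volume 0 1)
    (hlt : ∀ c ∈ Ioo (0 : ℝ) 1, zeta F m c < γ) : m {1} = 0 := by
  have hcont : ContinuousOn (fun c => ∫ z in c..1, F (1 - z)) (uIcc 0 1) := by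
    refine intervalIntegral.continuousOn_primitive_interval_left ?_
    rw [uIcc_of_le zero_le_one, integrableOn_Icc_iff_integrableOn_Ioc]
    exact hint.1
  have hlim : Tendsto (fun c => ENNReal.ofReal (γ * ∫ z in c..1, F (1 - z))) (𝓝[<] 1) (𝓝 0) := by
    have h1 := hcont 1 (by simp)
    rw [uIcc_of_le zero_le_one] at h1
    have h2 := (h1.mono Ioo_subset_Icc_self).tendsto
    rw [nhdsWithin_Ioo_eq_nhdsLT zero_lt_one] at h2
    simpa using ENNReal.tendsto_ofReal (h2.const_mul γ)
  refine le_antisymm (ge_of_tendsto hlim ?_) zero_le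
  filter_upwards [Ioo_mem_nhdsLT (zero_lt_one' ℝ)] with c hc
  refine (measure_mono ?_).trans (measure_Icc_lt_of_zeta_lt hF hint hc (hlt c hc)).le
  simpa using hc.2.le

/-- The real-valued extension by `L` to the left of `(0,1)` and by `0` to its right. -/
def extendIco (G : ℝ → ℝ) (L : ℝ) : ℝ → ℝ :=
  fun z => if z ≤ 0 then L else if z < 1 then G z else 0

lemma extendIco_of_mem {G : ℝ → ℝ} {L z : ℝ} (hz : z ∈ Ioo (0 : ℝ) 1) : extendIco G L z = G z := by
  simp [extendIco, hz.1.not_ge, hz.2]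

lemma objVal_lt_of_feasible [IsProbabilityMeasure m] (hm : m (Icc (0 : ℝ) 1)ᶜ = 0) (hx : 0 < x)
    (hF : ∀ z ∈ Ioo (0 : ℝ) 1, 0 < F z)
    (hint : IntervalIntegrable (fun z => F (1 - z)) volume 0 1) (hγ : 0 < γ)
    (hone : 1 < γ * ∫ z in (0 : ℝ)..1, F (1 - z))
    (hlt : ∀ c ∈ Ioo (0 : ℝ) 1, zeta F m c < γ) {G : ℝ → ℝ} (hG : Feasible F x G) :
    objVal m G < ENNReal.ofReal (γ * x) := by
  obtain ⟨hmono, -, ⟨L, hL, hlim⟩, hbudget⟩ := hG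
  have hm1 : m (Ico (0 : ℝ) 1)ᶜ = 0 := by
    refine measure_mono_null (t := (Icc (0 : ℝ) 1)ᶜ ∪ {1}) (fun z hz => ?_)
      (measure_union_null hm (measure_singleton_one_eq_zero hF hint hlt))
    by_contra h
    simp only [mem_union, mem_compl_iff, mem_Icc, mem_singleton_iff, not_or, not_not] at h
    exact hz ⟨h.1.1, lt_of_le_of_ne h.1.2 h.2⟩
  have hLG : ∀ z ∈ Ioo (0 : ℝ) 1, L ≤ G z := by
    intro z hz
    refine le_of_tendsto hlim ?_
    filter_upwards [Ioo_mem_nhdsGT hz.1] with y hy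
    exact hmono ⟨hy.1, hy.2.trans hz.2⟩ hz hy.2.le
  set g := extendIco G L with hgdef
  have hg0 : ∀ z, 0 ≤ g z := by
    intro z
    rw [hgdef, extendIco]
    split_ifs with h1 h2
    · exact hL
    · exact hL.trans (hLG z ⟨not_le.1 h1, h2⟩)
    · exact le_rfl
  have hgmono : MonotoneOn g (Ico 0 1) := by
    intro a ha b hb hab
    rcases hb.1.eq_or_lt with h | h
    · rw [le_antisymm hab (h.symm.le.trans ha.1)]
    rw [hgdef, extendIco_of_mem ⟨h, hb.2⟩]
    rcases ha.1.eq_or_lt with h' | h'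
    · simpa [extendIco, ← h'] using hLG b ⟨h, hb.2⟩
    · rw [extendIco_of_mem ⟨h', ha.2⟩]
      exact hmono ⟨h', ha.2⟩ ⟨h, hb.2⟩ hab
  have hgm : AEMeasurable g m := by
    have h := aemeasurable_restrict_of_monotoneOn (μ := m) measurableSet_Ico hgmono
    rwa [Measure.restrict_eq_self_of_ae_mem (s := Ico (0 : ℝ) 1) (mem_ae_iff.2 hm1)] at h
  have hgvol : AEMeasurable g (volume.restrict (Ioo 0 1)) :=
    aemeasurable_restrict_of_monotoneOn measurableSet_Ioo (hgmono.mono Ioo_subset_Ico_self)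
  have hwm : AEMeasurable (fun z => F (1 - z)) (volume.restrict (Ioo 0 1)) :=
    (hint.1.mono_set Ioo_subset_Ioc_self).aemeasurable
  have hwm' : AEMeasurable (fun z => ENNReal.ofReal (γ * F (1 - z)))
      (volume.restrict (Ioo 0 1)) := (hwm.const_mul γ).ennreal_ofReal
  have hobj : objVal m G ≤ ∫⁻ z, ENNReal.ofReal (g z) ∂m := by
    refine lintegral_mono_ae ?_
    filter_upwards [mem_ae_iff.2 hm1] with z hz
    rcases hz.1.eq_or_lt with h | h
    · have hz0 : g z = L := by simp [hgdef, extendIco, ← h]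
      rw [hz0, Gbar, if_pos h.symm]
      refine ge_of_tendsto (ENNReal.tendsto_ofReal hlim) ?_
      filter_upwards [Ioo_mem_nhdsGT (zero_lt_one' ℝ)] with y hy
      exact iInf₂_le y hy
    · rw [hgdef, extendIco_of_mem ⟨h, hz.2⟩, Gbar, if_neg h.ne', if_neg hz.2.ne]
  set ν := (volume.restrict (Ioo (0 : ℝ) 1)).withDensity
    (fun z => ENNReal.ofReal (γ * F (1 - z))) with hν
  have hνtail : ∀ c ∈ Ico (0 : ℝ) 1,
      ν (Ioo c 1) = ENNReal.ofReal (γ * ∫ z in c..1, F (1 - z)) := by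
    intro c hc
    rw [hν, withDensity_apply _ measurableSet_Ioo, Measure.restrict_restrict measurableSet_Ioo,
      inter_eq_left.2 (Ioo_subset_Ioo_left hc.1), setLIntegral_comp_one_sub hF hint hγ.le hc]
  have hνg : ∫⁻ z, ENNReal.ofReal (g z) ∂ν ≤ ENNReal.ofReal (γ * x) := by
    rw [hν, lintegral_withDensity_eq_lintegral_mul₀ hwm' hgvol.ennreal_ofReal,
      ENNReal.ofReal_mul hγ.le]
    refine le_trans (le_of_eq ?_) (mul_le_mul_right hbudget _)
    rw [← lintegral_const_mul' _ _ ENNReal.ofReal_ne_top]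
    refine setLIntegral_congr_fun measurableSet_Ioo fun z hz => ?_
    have hFz : 0 ≤ F (1 - z) := (hF _ ⟨by linarith [hz.2], by linarith [hz.1]⟩).le
    simp only [Pi.mul_apply]
    rw [hgdef, extendIco_of_mem hz, ← ENNReal.ofReal_mul hγ.le,
      ← ENNReal.ofReal_mul (mul_nonneg hγ.le hFz), mul_assoc]
  refine hobj.trans_lt ?_
  by_cases hpos : ∃ z ∈ Ioo (0 : ℝ) 1, 0 < g z
  · refine (lintegral_lt_of_tail_lt hm1 ?_ ?_ hgmono hg0 hgm
      (hgvol.mono_ac (withDensity_absolutelyContinuous _ _))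
      (ne_top_of_le_ne_top ENNReal.ofReal_ne_top hνg) hpos).trans_le hνg
    · rw [hνtail 0 (by simp)]
      exact prob_le_one.trans_lt (ENNReal.one_lt_ofReal.2 hone)
    · intro c hc
      rw [hνtail c (Ioo_subset_Ico_self hc)]
      exact measure_Icc_lt_of_zeta_lt hF hint hc (hlt c hc)
  · have : ∫⁻ z, ENNReal.ofReal (g z) ∂m = 0 := by
      refine lintegral_eq_zero_of_ae_eq_zero ?_
      filter_upwards [mem_ae_iff.2 hm1] with z hz
      have h2 : ((z + 1) / 2) ∈ Ioo (0 : ℝ) 1 :=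
        ⟨by linarith [hz.1], by linarith [hz.2]⟩
      have h3 := hgmono hz (Ioo_subset_Ico_self h2) (by linarith [hz.2])
      simpa using h3.trans (not_lt.1 fun h => hpos ⟨_, h2, h⟩)
    rw [this]
    exact ENNReal.ofReal_pos.2 (mul_pos hγ hx)

lemma feasible_step (hF : ∀ z ∈ Ioo (0 : ℝ) 1, 0 < F z)
    (hint : IntervalIntegrable (fun z => F (1 - z)) volume 0 1) (hx : 0 ≤ x) {c : ℝ}
    (hc : c ∈ Ioo (0 : ℝ) 1) :
    Feasible F x ((Ici c).indicator fun _ => x / ∫ z in c..1, F (1 - z)) := by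
  have hW := intervalIntegral_comp_one_sub_pos hF hint (Ioo_subset_Ico_self hc)
  set a := x / ∫ z in c..1, F (1 - z) with ha
  have ha0 : 0 ≤ a := div_nonneg hx hW.le
  refine ⟨?_, fun z _ => ?_, ⟨0, le_rfl, ?_⟩, ?_⟩
  · intro y _ z _ hyz
    by_cases h : c ≤ y
    · simp [indicator, h, h.trans hyz]
    · simp only [indicator, mem_Ici, h, if_false]
      split_ifs <;> simp [ha0]
  · refine tendsto_const_nhds.congr' ?_
    by_cases h : c ≤ z
    · filter_upwards [self_mem_nhdsWithin] with y hy
      simp [indicator, h, h.trans (le_of_lt hy)]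
    · filter_upwards [Ioo_mem_nhdsGT (not_le.1 h)] with y hy
      simp [indicator, h, hy.2]
  · refine tendsto_const_nhds.congr' ?_
    filter_upwards [Ioo_mem_nhdsGT hc.1] with y hy
    simp [indicator, hy.2]
  · have hEq : ∀ z, ENNReal.ofReal (F (1 - z) * (Ici c).indicator (fun _ => a) z)
        = (Ici c).indicator (fun z => ENNReal.ofReal (a * F (1 - z))) z := by
      intro z
      by_cases h : c ≤ z <;> simp [indicator, h, mul_comm]
    simp_rw [hEq]
    rw [lintegral_indicator measurableSet_Ici, Measure.restrict_restrict measurableSet_Ici]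
    have hset : Ici c ∩ Ioo (0 : ℝ) 1 = Ico c 1 := by
      ext z
      simp only [mem_inter_iff, mem_Ici, mem_Ioo, mem_Ico]
      exact ⟨fun h => ⟨h.1, h.2.2⟩, fun h => ⟨h.1, hc.1.trans_le h.1, h.2⟩⟩
    rw [hset, setLIntegral_congr Ioo_ae_eq_Ico.symm,
      setLIntegral_comp_one_sub hF hint ha0 (Ioo_subset_Ico_self hc), ha, div_mul_cancel₀ _ hW.ne']

lemma objVal_step_ge [IsFiniteMeasure m] (hF : ∀ z ∈ Ioo (0 : ℝ) 1, 0 < F z)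
    (hint : IntervalIntegrable (fun z => F (1 - z)) volume 0 1) (hx : 0 ≤ x) {c : ℝ}
    (hc : c ∈ Ioo (0 : ℝ) 1) :
    ENNReal.ofReal (zeta F m c * x)
      ≤ objVal m ((Ici c).indicator fun _ => x / ∫ z in c..1, F (1 - z)) := by
  have hW := intervalIntegral_comp_one_sub_pos hF hint (Ioo_subset_Ico_self hc)
  set a := x / ∫ z in c..1, F (1 - z) with ha
  have ha0 : 0 ≤ a := div_nonneg hx hW.le
  have hval : ENNReal.ofReal (zeta F m c * x) = ENNReal.ofReal a * m (Icc c 1) := by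
    rw [← ENNReal.ofReal_toReal (measure_ne_top m (Icc c 1)), ← ENNReal.ofReal_mul ha0, ha, zeta]
    congr 1
    ring
  rw [hval, ← lintegral_indicator_const measurableSet_Icc]
  refine lintegral_mono fun z => ?_
  refine indicator_le' (f := fun _ => ENNReal.ofReal a) (fun z hz => ?_)
    (fun _ _ => zero_le) z
  rw [Gbar, if_neg (hc.1.trans_le hz.1).ne']
  split_ifs with h
  · refine le_trans (le_of_eq ?_) (le_iSup₂ (f := fun y (_ : y ∈ Ioo (0 : ℝ) 1) =>
      ENNReal.ofReal ((Ici c).indicator (fun _ => a) y)) c hc)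
    simp
  · simp [indicator, hz.1]

end Pricing

/-- if `1/δ < γ* < +∞` and `ζ(c) < γ*` for every `c ∈ (0,1)`, then every
feasible quantile function has objective value strictly less than `γ*·x`, and `γ*·x`
is the supremum of the objective value over feasible quantile functions; hence the
supremum is not attained. -/
theorem no_optimal_of_not_attained
    {Ω : Type*} [MeasurableSpace Ω] (μ : Measure Ω) [IsProbabilityMeasure μ]
    (ρ : Ω → ℝ) (hρmeas : Measurable ρ) (hρpos : ∀ ω, 0 < ρ ω)
    (hρint : Integrable ρ μ) (hcdf : Continuous (cdfFun μ ρ))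
    (m : Measure ℝ) [IsProbabilityMeasure m] (hm : m (Set.Icc (0:ℝ) 1)ᶜ = 0)
    (x δ : ℝ) (hx : 0 < x) (hδpos : 0 < δ)
    (hδ1 : δ = ∫ ω, ρ ω ∂μ) (hδ2 : δ = ∫ z in (0:ℝ)..1, rcInv μ ρ (1 - z))
    (γstar : ℝ) (hlub : IsLUB (zeta (rcInv μ ρ) m '' Set.Ioo 0 1) γstar)
    (hgt : 1 / δ < γstar)
    (hna : ∀ c ∈ Set.Ioo (0:ℝ) 1, zeta (rcInv μ ρ) m c < γstar) :
    (∀ G : ℝ → ℝ, Feasible (rcInv μ ρ) x G → objVal m G < ENNReal.ofReal (γstar * x))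
    ∧ (⨆ (G : ℝ → ℝ) (_ : Feasible (rcInv μ ρ) x G), objVal m G)
        = ENNReal.ofReal (γstar * x) := by
  have hF : ∀ z ∈ Ioo (0 : ℝ) 1, 0 < rcInv μ ρ z := fun z hz => rcInv_pos μ hρmeas hρpos hcdf hz
  have hint : IntervalIntegrable (fun z => rcInv μ ρ (1 - z)) volume 0 1 := by
    by_contra h
    rw [intervalIntegral.integral_undef h] at hδ2
    exact hδpos.ne' hδ2
  have hγ : 0 < γstar := (one_div_pos.2 hδpos).trans hgt
  have hone : 1 < γstar * ∫ z in (0 : ℝ)..1, rcInv μ ρ (1 - z) := by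
    rwa [← hδ2, ← div_lt_iff₀ hδpos]
  have hupper : ∀ G : ℝ → ℝ, Feasible (rcInv μ ρ) x G →
      objVal m G < ENNReal.ofReal (γstar * x) :=
    fun G hG => objVal_lt_of_feasible hm hx hF hint hγ hone hna hG
  refine ⟨hupper, le_antisymm (iSup₂_le fun G hG => (hupper G hG).le) ?_⟩
  refine le_of_forall_lt fun b hb => ?_
  have hbx : b.toReal / x < γstar := by
    rw [div_lt_iff₀ hx]
    exact (ENNReal.lt_ofReal_iff_toReal_lt hb.ne_top).1 hb
  obtain ⟨_, ⟨c, hc, rfl⟩, hbc⟩ := (lt_isLUB_iff hlub).1 hbx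
  rw [div_lt_iff₀ hx] at hbc
  calc b < ENNReal.ofReal (zeta (rcInv μ ρ) m c * x) :=
        (ENNReal.lt_ofReal_iff_toReal_lt hb.ne_top).2 hbc
    _ ≤ _ := objVal_step_ge hF hint hx.le hc
    _ ≤ _ := le_iSup₂ (f := fun G (_ : Feasible (rcInv μ ρ) x G) => objVal m G) _
        (feasible_step hF hint hx.le hc)
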